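/- arXiv:2605.16948 — 12 statements merged into one kernel-verified Lean document; each statement's English description precedes it below -/
import Mathlib

section
/- Let G be a simple graph on a finite vertex type, let c1 and c2 be proper colorings of G, let k be a natural number, and let S and D be disjoint finite sets of vertices such that nonEdges(S ∪ D) ≤ k (i.e., S ∪ D induces a k-defective clique). Then the number of unordered pairs {u,v} of distinct vertices of D with c1(u) = c1(v) or c2(u) = c2(v), plus Σ_{u ∈ D} d̄_S(u), plus nonEdges(S), is at most k. -/
/-- The number of unordered pairs `{u,v}` of distinct vertices of `T`
that are not adjacent in `G`. -/
def nonEdges {V : Type*} [DecidableEq V] (G : SimpleGraph V) [DecidableRel G.Adj]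
    (T : Finset V) : ℕ :=
  (T.offDiag.filter fun p => ¬ G.Adj p.1 p.2).card / 2

/-- The number of vertices `w ∈ S` with `w ≠ u` that are not adjacent to `u` in `G`,
i.e. the non-degree `d̄_S(u)`. -/
def nonDeg {V : Type*} [DecidableEq V] (G : SimpleGraph V) [DecidableRel G.Adj]
    (S : Finset V) (u : V) : ℕ :=
  (S.filter fun w => w ≠ u ∧ ¬ G.Adj u w).card

theorem stmt_2 {V A B : Type*} [Fintype V] [DecidableEq V]
    [DecidableEq A] [DecidableEq B]
    (G : SimpleGraph V) [DecidableRel G.Adj]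
    (c1 : V → A) (c2 : V → B)
    (hc1 : ∀ u v, G.Adj u v → c1 u ≠ c1 v)
    (hc2 : ∀ u v, G.Adj u v → c2 u ≠ c2 v)
    (k : ℕ) (S D : Finset V) (hSD : Disjoint S D)
    (hk : nonEdges G (S ∪ D) ≤ k) :
    (D.offDiag.filter fun p => c1 p.1 = c1 p.2 ∨ c2 p.1 = c2 p.2).card / 2
      + ∑ u ∈ D, nonDeg G S u + nonEdges G S ≤ k := by
  classical
  have hY1 : ∑ u ∈ D, nonDeg G S u = ((D ×ˢ S).filter fun p => ¬ G.Adj p.1 p.2).card := by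
    rw [Finset.card_filter, Finset.sum_product]
    refine Finset.sum_congr rfl fun u hu => ?_
    unfold nonDeg
    rw [← Finset.card_filter]
    congr 1
    refine Finset.filter_congr fun w hw => ?_
    have : w ≠ u := fun h => Finset.disjoint_left.mp hSD hw (h ▸ hu)
    simp [this]
  have hY2 : ((S ×ˢ D).filter fun p => ¬ G.Adj p.1 p.2).card
      = ((D ×ˢ S).filter fun p => ¬ G.Adj p.1 p.2).card := by
    refine Finset.card_bij (fun p _ => p.swap) ?_ ?_ ?_
    · intro p hp
      simp only [Finset.mem_filter, Finset.mem_product, Prod.fst_swap, Prod.snd_swap] at hp ⊢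
      exact ⟨hp.1.symm, fun h => hp.2 h.symm⟩
    · intro p _ q _ h
      exact Prod.swap_injective h
    · intro p hp
      simp only [Finset.mem_filter, Finset.mem_product] at hp
      refine ⟨p.swap, ?_, Prod.swap_swap p⟩
      simp only [Finset.mem_filter, Finset.mem_product, Prod.fst_swap, Prod.snd_swap]
      exact ⟨hp.1.symm, fun h => hp.2 h.symm⟩
  have hX : (D.offDiag.filter fun p => c1 p.1 = c1 p.2 ∨ c2 p.1 = c2 p.2).card
      ≤ (D.offDiag.filter fun p => ¬ G.Adj p.1 p.2).card := by
    refine Finset.card_le_card (Finset.monotone_filter_right _ ?_)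
    rintro p _ (h | h) ha
    · exact hc1 _ _ ha h
    · exact hc2 _ _ ha h
  have hU : ((S ∪ D).offDiag.filter fun p => ¬ G.Adj p.1 p.2).card
      = (S.offDiag.filter fun p => ¬ G.Adj p.1 p.2).card
      + (D.offDiag.filter fun p => ¬ G.Adj p.1 p.2).card
      + ((S ×ˢ D).filter fun p => ¬ G.Adj p.1 p.2).card
      + ((D ×ˢ S).filter fun p => ¬ G.Adj p.1 p.2).card := by
    have hd := Finset.disjoint_left.mp hSD
    rw [Finset.offDiag_union hSD, Finset.filter_union, Finset.filter_union, Finset.filter_union,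
      Finset.card_union_of_disjoint, Finset.card_union_of_disjoint, Finset.card_union_of_disjoint]
    all_goals
      rw [Finset.disjoint_left]
      intro p hp hq
      simp only [Finset.mem_union, Finset.mem_filter, Finset.mem_product,
        Finset.mem_offDiag] at hp hq
      have h1 := @hd p.1
      have h2 := @hd p.2
      tauto
  rw [hY1]
  unfold nonEdges at hk ⊢
  omega
end

section
/- For every integer k ≥ 1, there exists exactly one real number x > 1 with x^{k+4} − 2x^{k+3} + x^3 − x + 1 = 0, and this unique root satisfies 1 < x < 2. -/
theorem aux_lt (k : ℕ) (a b : ℝ) (ha : 0 < a) (hab : a < b) :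
    a * ∑ i ∈ Finset.range k, a ^ i + a ^ (k + 3) < b * ∑ i ∈ Finset.range k, b ^ i + b ^ (k + 3) := by
  have h1 : ∑ i ∈ Finset.range k, a ^ i ≤ ∑ i ∈ Finset.range k, b ^ i :=
    Finset.sum_le_sum fun i _ => pow_le_pow_left₀ ha.le hab.le i
  have h2 : a ^ (k + 3) < b ^ (k + 3) := pow_lt_pow_left₀ hab ha.le (by omega)
  have h3 : 0 ≤ ∑ i ∈ Finset.range k, a ^ i := Finset.sum_nonneg fun i _ => by positivity
  have h4 := mul_le_mul hab.le h1 h3 (ha.le.trans hab.le)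
  linarith

theorem aux_iff (k : ℕ) (x : ℝ) (hx : 1 < x) :
    x ^ (k + 4) - 2 * x ^ (k + 3) + x ^ 3 - x + 1 = 0 ↔
    x⁻¹ * ∑ i ∈ Finset.range k, x⁻¹ ^ i + x⁻¹ ^ (k + 3) = 1 := by
  have h0 : 0 < x := by linarith
  have hy1 : x⁻¹ < 1 := inv_lt_one_of_one_lt₀ hx
  have hxy : x * x⁻¹ = 1 := mul_inv_cancel₀ h0.ne'
  have hy0 : 0 < x⁻¹ := inv_pos.2 h0
  generalize x⁻¹ = y at *
  have hg := geom_sum_mul y k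
  have hp : x ^ k * y ^ k = 1 := by rw [← mul_pow, hxy, one_pow]
  generalize ∑ i ∈ Finset.range k, y ^ i = S at *
  have key : (x ^ (k + 4) - 2 * x ^ (k + 3) + x ^ 3 - x + 1) =
      x ^ (k + 4) * ((1 - y) * (1 - (y * S + y ^ (k + 3)))) := by
    have e1 : (1 - y) * (1 - (y * S + y ^ (k + 3))) = 
      1 - 2 * y + y ^ k * y - y ^ k * y ^ 3 + y ^ k * y ^ 4 := by
      linear_combination y * hg
    have e2 : x ^ 4 * y = x ^ 3 := by linear_combination x ^ 3 * hxy
    have e3 : x ^ 4 * y ^ 3 = x := by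
      linear_combination (x ^ 3 * y ^ 2 + x ^ 2 * y + x) * hxy
    have e4 : x ^ 4 * y ^ 4 = 1 := by rw [← mul_pow, hxy, one_pow]
    rw [e1]
    simp only [pow_add] at *
    linear_combination (2 * x ^ k - x ^ k * y ^ k) * e2 + x ^ k * y ^ k * e3 - x ^ k * y ^ k * e4 -
      (x ^ 3 - x + 1) * hp
  rw [key]
  have p1 : x ^ (k + 4) ≠ 0 := by positivity
  have p2 : 1 - y ≠ 0 := by linarith
  simp only [mul_eq_zero, p1, p2, false_or]
  constructor <;> intro h <;> linarith

theorem stmt_7 (k : ℕ) (hk : 1 ≤ k) :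
    (∃! x : ℝ, 1 < x ∧ x ^ (k + 4) - 2 * x ^ (k + 3) + x ^ 3 - x + 1 = 0) ∧
    (∀ x : ℝ, 1 < x → x ^ (k + 4) - 2 * x ^ (k + 3) + x ^ 3 - x + 1 = 0 → x < 2) := by
  refine ⟨?_, ?_⟩
  · obtain ⟨y, hy, hF⟩ : ∃ y ∈ Set.Ioo (1/2 : ℝ) 1,
        y * ∑ i ∈ Finset.range k, y ^ i + y ^ (k + 3) = 1 := by
      have hc : ContinuousOn (fun y : ℝ => y * ∑ i ∈ Finset.range k, y ^ i + y ^ (k + 3))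
        (Set.Icc (1/2) 1) := by fun_prop
      have := intermediate_value_Ioo (by norm_num : (1/2 : ℝ) ≤ 1) hc
      refine this ⟨?_, ?_⟩
      · have hg := geom_sum_mul (1/2 : ℝ) k
        have hp : (0:ℝ) < (1/2) ^ k := by positivity
        simp only [pow_add]
        linarith
      · have : (1:ℝ) ≤ k := by exact_mod_cast hk
        simp
        omega
    have hy0 : 0 < y := by linarith [hy.1]
    have h1 : 1 < y⁻¹ := (one_lt_inv₀ hy0).2 hy.2
    refine ⟨y⁻¹, ⟨h1, ?_⟩, ?_⟩
    · rw [aux_iff k _ h1, inv_inv]; exact hF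
    · rintro z ⟨hz, hz2⟩
      rw [aux_iff k z hz] at hz2
      have hz0 : 0 < z⁻¹ := inv_pos.2 (by linarith)
      rcases lt_trichotomy z⁻¹ y with h | h | h
      · have := aux_lt k _ _ hz0 h
        linarith
      · rw [← h, inv_inv]
      · have := aux_lt k _ _ hy0 h
        linarith
  · intro x hx h
    by_contra hc
    have h2 : 2 ≤ x := not_lt.1 hc
    have h3 : 0 ≤ x ^ (k + 3) * (x - 2) := mul_nonneg (by positivity) (by linarith)
    have h4 : x ^ (k + 4) = x ^ (k + 3) * x := pow_succ _ _
    have h5 : 0 < x ^ 3 - x + 1 := by nlinarith [mul_pos (by linarith : 0 < x) (by nlinarith : 0 < x ^ 2 - 1)]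
    linarith
end

section
/- For every integer k ≥ 1, there exists exactly one real number x > 1 with x^{k+3} − 2x^{k+2} + x^2 − x + 1 = 0, and this unique root satisfies 1 < x < 2. -/
theorem stmt8_geo (k : ℕ) (y : ℝ) :
    (1 - y) * ∑ j ∈ Finset.range k, y ^ (j + 1) = y - y ^ (k + 1) := by
  induction k with
  | zero => simp
  | succ n ih => rw [Finset.sum_range_succ, mul_add, ih]; ring

theorem stmt8_key (k : ℕ) (y : ℝ) (h0 : 0 < y) (h1 : y < 1) :
    (y⁻¹ ^ (k + 3) - 2 * y⁻¹ ^ (k + 2) + y⁻¹ ^ 2 - y⁻¹ + 1 = 0) ↔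
      y ^ (k + 2) + ∑ j ∈ Finset.range k, y ^ (j + 1) = 1 := by
  have hg := stmt8_geo k y
  set S := ∑ j ∈ Finset.range k, y ^ (j + 1)
  have e : y ^ (k + 3) * (y⁻¹ ^ (k + 3) - 2 * y⁻¹ ^ (k + 2) + y⁻¹ ^ 2 - y⁻¹ + 1)
      = (1 - y) * (1 - (y ^ (k + 2) + S)) := by
    have e1 : y ^ (k + 3) * (y⁻¹ ^ (k + 3) - 2 * y⁻¹ ^ (k + 2) + y⁻¹ ^ 2 - y⁻¹ + 1)
      = 1 - 2 * y + y ^ (k + 1) - y ^ (k + 2) + y ^ (k + 3) := by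
      have : y ≠ 0 := h0.ne'
      simp only [inv_pow, pow_add]
      field_simp
    rw [e1]
    linear_combination hg
  have hp : y ^ (k + 3) ≠ 0 := by positivity
  constructor
  · intro h
    rw [h, mul_zero] at e
    rcases mul_eq_zero.1 e.symm with h | h <;> linarith
  · intro h
    rw [h, sub_self, mul_zero] at e
    exact (mul_eq_zero.1 e).resolve_left hp

theorem stmt8_mono (k : ℕ) (y z : ℝ) (h0 : 0 < y) (h : y < z) :
    y ^ (k + 2) + ∑ j ∈ Finset.range k, y ^ (j + 1)
      < z ^ (k + 2) + ∑ j ∈ Finset.range k, z ^ (j + 1) := by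
  have h1 : y ^ (k + 2) < z ^ (k + 2) := pow_lt_pow_left₀ h h0.le (by omega)
  have h2 : ∑ j ∈ Finset.range k, y ^ (j + 1) ≤ ∑ j ∈ Finset.range k, z ^ (j + 1) :=
    Finset.sum_le_sum fun j _ => pow_le_pow_left₀ h0.le h.le _
  linarith

theorem stmt_8 (k : ℕ) (hk : 1 ≤ k) :
    (∃! x : ℝ, 1 < x ∧ x ^ (k + 3) - 2 * x ^ (k + 2) + x ^ 2 - x + 1 = 0) ∧
    (∀ x : ℝ, 1 < x → x ^ (k + 3) - 2 * x ^ (k + 2) + x ^ 2 - x + 1 = 0 → x < 2) := by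
  constructor
  · have hc : ContinuousOn (fun y : ℝ => y ^ (k + 2) + ∑ j ∈ Finset.range k, y ^ (j + 1))
        (Set.Icc (1/2) 1) := by fun_prop
    have hiv := intermediate_value_Ioo (by norm_num : (1/2 : ℝ) ≤ 1) hc
    have hm : (1 : ℝ) ∈ Set.Ioo ((1/2 : ℝ) ^ (k + 2) + ∑ j ∈ Finset.range k, (1/2 : ℝ) ^ (j + 1))
        ((1 : ℝ) ^ (k + 2) + ∑ j ∈ Finset.range k, (1 : ℝ) ^ (j + 1)) := by
      constructor
      · have hg := stmt8_geo k (1/2)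
        have hp : (0 : ℝ) < (1/2) ^ k := by positivity
        have e1 : (1/2 : ℝ) ^ (k + 1) = (1/2) ^ k * (1/2) := pow_succ _ _
        have e2 : (1/2 : ℝ) ^ (k + 2) = (1/2) ^ k * (1/4) := by rw [pow_add]; norm_num
        rw [e1] at hg
        rw [e2]
        linarith
      · have : (1 : ℝ) ≤ k := by exact_mod_cast hk
        simp
        linarith
    obtain ⟨y, ⟨hy1, hy2⟩, hy⟩ := hiv hm
    have hy0 : 0 < y := by linarith
    refine ⟨y⁻¹, ⟨(one_lt_inv₀ hy0).2 hy2, (stmt8_key k y hy0 hy2).2 hy⟩, ?_⟩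
    rintro x ⟨hx1, hx⟩
    have hx0 : 0 < x := by linarith
    have hz0 : 0 < x⁻¹ := inv_pos.2 hx0
    have hz := (stmt8_key k x⁻¹ hz0 (inv_lt_one_of_one_lt₀ hx1)).1 (by rwa [inv_inv])
    have : x⁻¹ = y := by
      simp only at hy
      rcases lt_trichotomy x⁻¹ y with h | h | h
      · have := stmt8_mono k _ _ hz0 h
        linarith
      · exact h
      · have := stmt8_mono k _ _ hy0 h
        linarith
    rw [← this, inv_inv]
  · intro x hx h
    by_contra! h2
    have hp : 0 ≤ x ^ (k + 2) * (x - 2) := mul_nonneg (by positivity) (by linarith)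
    have e : x ^ (k + 3) = x ^ (k + 2) * x := pow_succ _ _
    rw [e] at h
    nlinarith
end

section
/- For every integer k ≥ 1, if λ and γ are real numbers with λ > 1, γ > 1, λ^{k+4} − 2λ^{k+3} + λ^3 − λ + 1 = 0, and γ^{k+3} − 2γ^{k+2} + γ^2 − γ + 1 = 0, then λ < γ. -/
theorem stmt_9 (k : ℕ) (hk : 1 ≤ k) (lam gam : ℝ)
    (hlam : 1 < lam) (hgam : 1 < gam)
    (hP : lam ^ (k + 4) - 2 * lam ^ (k + 3) + lam ^ 3 - lam + 1 = 0)
    (hQ : gam ^ (k + 3) - 2 * gam ^ (k + 2) + gam ^ 2 - gam + 1 = 0) :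
    lam < gam := by
  by_contra hcon
  have hle : gam ≤ lam := not_lt.mp hcon
  have hl0 : 0 < lam := by linarith
  have hg0 : 0 < gam := by linarith
  have el := geom_sum_mul lam k
  have eg := geom_sum_mul gam k
  have hsum : gam ^ k * (lam ^ 2 * ∑ i ∈ Finset.range k, lam ^ i)
      ≤ lam ^ k * (lam ^ 2 * ∑ i ∈ Finset.range k, gam ^ i) := by
    rw [Finset.mul_sum, Finset.mul_sum, Finset.mul_sum, Finset.mul_sum]
    apply Finset.sum_le_sum
    intro i hi
    obtain ⟨j, rfl⟩ := Nat.exists_eq_add_of_lt (Finset.mem_range.mp hi)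
    have h1 : gam ^ (j + 1) ≤ lam ^ (j + 1) := pow_le_pow_left₀ hg0.le hle _
    have h2 : 0 ≤ gam ^ i * lam ^ i * lam ^ 2 := by positivity
    have h3 := mul_le_mul_of_nonneg_left h1 h2
    calc _ = gam ^ i * lam ^ i * lam ^ 2 * gam ^ (j + 1) := by ring
      _ ≤ _ := h3
      _ = _ := by ring
  have hpow : gam ^ (k + 2) ≤ lam ^ (k + 2) := pow_le_pow_left₀ hg0.le hle _
  generalize (∑ i ∈ Finset.range k, lam ^ i) = A at *
  generalize (∑ i ∈ Finset.range k, gam ^ i) = B at *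
  have hG : gam ^ (k + 2) = 1 + gam ^ 2 * B := by
    have : (gam - 1) * (gam ^ (k + 2) - (1 + gam ^ 2 * B)) = 0 := by
      linear_combination hQ - gam ^ 2 * eg
    rcases mul_eq_zero.mp this with h | h <;> linarith
  have hL : lam ^ (k + 2) < 1 + lam ^ 2 * A := by
    have h : (lam * (lam - 1)) * (lam ^ (k + 2) - (1 + lam ^ 2 * A)) = -(lam - 1) ^ 2 := by
      linear_combination hP - lam ^ 3 * el
    have h1 : 0 < (lam - 1) ^ 2 := by
      have : 0 < lam - 1 := by linarith
      positivity
    have h2 : 0 < lam * (lam - 1) := mul_pos hl0 (by linarith)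
    by_contra hc
    have := mul_nonneg h2.le (sub_nonneg.mpr (not_lt.mp hc))
    linarith
  have hg : 0 < gam ^ (k + 2) := by positivity
  have h1 := mul_lt_mul_of_pos_left hL hg
  have h2 := mul_le_mul_of_nonneg_left hsum (sq_nonneg gam)
  have h3 : gam ^ (k + 2) * lam ^ (k + 2) = lam ^ (k + 2) * (1 + gam ^ 2 * B) := by
    rw [hG]; ring
  have e1 : gam ^ (k + 2) * (lam ^ 2 * A) = gam ^ 2 * (gam ^ k * (lam ^ 2 * A)) := by ring
  have e2 : lam ^ (k + 2) * (gam ^ 2 * B) = gam ^ 2 * (lam ^ k * (lam ^ 2 * B)) := by ring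
  linarith
end

section
/- For every integer k ≥ 1, if λ and λ' are real numbers with 1 < λ < 2, 1 < λ' < 2, λ^{k+4} − 2λ^{k+3} + λ^3 − λ + 1 = 0, and λ'^{k+5} − 2λ'^{k+4} + λ'^3 − λ' + 1 = 0, then λ < λ'. -/
theorem aux_root (k : ℕ) (x : ℝ) (hx : 1 < x)
    (h : x ^ (k + 4) - 2 * x ^ (k + 3) + x ^ 3 - x + 1 = 0) :
    (∑ i ∈ Finset.range k, (x⁻¹) ^ i) * x⁻¹ + (x⁻¹) ^ (k + 3) = 1 := by
  have hx0 : x ≠ 0 := by positivity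
  have hy : x⁻¹ < 1 := inv_lt_one_of_one_lt₀ hx
  have hxy : x * x⁻¹ = 1 := mul_inv_cancel₀ hx0
  have hg := geom_sum_mul (x⁻¹) k
  have hpk : x ^ k * (x⁻¹) ^ k = 1 := by rw [← mul_pow, hxy, one_pow]
  generalize x⁻¹ = y at *
  generalize (∑ i ∈ Finset.range k, y ^ i) = S at *
  have e : 1 - 2 * y + y ^ (k + 1) - y ^ (k + 3) + y ^ (k + 4) = 0 := by
    have h2 : y ^ k * y ^ 4 * (x ^ (k + 4) - 2 * x ^ (k + 3) + x ^ 3 - x + 1) = 0 := by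
      rw [h, mul_zero]
    have e3 : x ^ 3 * y ^ 3 = 1 := by rw [← mul_pow, hxy, one_pow]
    have e4 : x ^ 4 * y ^ 4 = 1 := by rw [← mul_pow, hxy, one_pow]
    have : y ^ k * y ^ 4 * (x ^ (k + 4) - 2 * x ^ (k + 3) + x ^ 3 - x + 1)
        = (x ^ k * y ^ k) * (x ^ 4 * y ^ 4) - 2 * y * ((x ^ k * y ^ k) * (x ^ 3 * y ^ 3))
          + y ^ (k + 1) * (x ^ 3 * y ^ 3) - y ^ (k + 3) * (x * y) + y ^ (k + 4) := by ring
    rw [this, hpk, e3, e4, hxy] at h2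
    linarith
  have h3 : (y - 1) * (S * y + y ^ (k + 3) - 1) = 0 := by
    linear_combination e + y * hg
  rcases mul_eq_zero.mp h3 with h4 | h4
  · linarith
  · linarith

theorem stmt_10 (k : ℕ) (hk : 1 ≤ k) (lam lam' : ℝ)
    (hlam1 : 1 < lam) (hlam2 : lam < 2)
    (hlam'1 : 1 < lam') (hlam'2 : lam' < 2)
    (hP : lam ^ (k + 4) - 2 * lam ^ (k + 3) + lam ^ 3 - lam + 1 = 0)
    (hP' : lam' ^ (k + 5) - 2 * lam' ^ (k + 4) + lam' ^ 3 - lam' + 1 = 0) :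
    lam < lam' := by
  by_contra! hle
  have h1 := aux_root k lam hlam1 hP
  have h2 := aux_root (k + 1) lam' hlam'1 hP'
  have hy0 : 0 < lam⁻¹ := by positivity
  have hy1 : lam⁻¹ < 1 := inv_lt_one_of_one_lt₀ hlam1
  have hyz : lam⁻¹ ≤ lam'⁻¹ := inv_anti₀ (by linarith) hle
  generalize lam⁻¹ = y at *
  generalize lam'⁻¹ = z at *
  have h3 : (∑ i ∈ Finset.range (k + 1), y ^ i) * y + y ^ (k + 1 + 3) ≤
      (∑ i ∈ Finset.range (k + 1), z ^ i) * z + z ^ (k + 1 + 3) := by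
    have hz0 : 0 ≤ z := by linarith
    gcongr
  rw [h2, Finset.sum_range_succ] at h3
  have h4 : 0 < y ^ k * y * (1 - y ^ 2) := by
    have : 0 < 1 - y ^ 2 := by nlinarith
    positivity
  have h5 : 0 < y ^ (k + 4) := by positivity
  have h6 : y ^ (k + 1 + 3) = y ^ (k + 4) := by ring
  have h7 : y ^ k * y * (1 - y ^ 2) = y ^ k * y - y ^ (k + 3) := by ring
  rw [add_mul, h6] at h3
  linarith
end

section
/- For every integer k ≥ 1 and every real number λ with 1 < λ < 2 and λ^{k+4} − 2λ^{k+3} + λ^3 − λ + 1 = 0, one has 0 < 2 − λ < 7 · λ^{−(k+3)}. -/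
theorem stmt_12 (k : ℕ) (hk : 1 ≤ k) (lam : ℝ)
    (hlam1 : 1 < lam) (hlam2 : lam < 2)
    (hP : lam ^ (k + 4) - 2 * lam ^ (k + 3) + lam ^ 3 - lam + 1 = 0) :
    0 < 2 - lam ∧ 2 - lam < 7 * lam ^ (-((k : ℤ) + 3)) := by
  refine ⟨by linarith, ?_⟩
  have hpos : 0 < lam ^ (k + 3) := by positivity
  have he : lam ^ (-((k : ℤ) + 3)) = (lam ^ (k + 3))⁻¹ := by
    rw [zpow_neg]
    norm_cast
  rw [he, ← div_eq_mul_inv, lt_div_iff₀ hpos]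
  have h1 : (2 - lam) * lam ^ (k + 3) = lam ^ 3 - lam + 1 := by
    have : lam ^ (k + 4) = lam * lam ^ (k + 3) := by ring
    rw [this] at hP
    linarith
  rw [h1]
  have h2 : 0 < (2 - lam) * (lam ^ 2 + 2 * lam + 3) :=
    mul_pos (by linarith) (by positivity)
  nlinarith [h2]
end

section
/- Let λ : ℕ → ℝ be a sequence such that for every integer k ≥ 1, 1 < λ_k < 2 and λ_k^{k+4} − 2λ_k^{k+3} + λ_k^3 − λ_k + 1 = 0. Then λ_k tends to 2 as k tends to infinity. -/
theorem stmt_13 (l : ℕ → ℝ)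
    (hl : ∀ k : ℕ, 1 ≤ k → 1 < l k ∧ l k < 2 ∧
      (l k) ^ (k + 4) - 2 * (l k) ^ (k + 3) + (l k) ^ 3 - l k + 1 = 0) :
    Filter.Tendsto l Filter.atTop (nhds 2) := by
  have key : ∀ k : ℕ, 1 ≤ k → 2 - (4/5 : ℝ) ^ k ≤ l k := by
    intro k hk
    obtain ⟨h1, h2, h3⟩ := hl k hk
    generalize l k = x at *
    have e : x ^ k * (x ^ 3 * (2 - x)) = x ^ 3 - x + 1 := by
      have : x ^ (k + 4) - 2 * x ^ (k + 3) = - (x ^ k * (x ^ 3 * (2 - x))) := by ring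
      linarith
    have hp : 0 < x ^ 3 * (2 - x) := mul_pos (by positivity) (by linarith)
    have hxk : x ≤ x ^ k := le_self_pow₀ h1.le (by omega)
    have h4 : x * (x ^ 3 * (2 - x)) ≤ x ^ 3 - x + 1 := by
      rw [← e]; exact mul_le_mul_of_nonneg_right hxk hp.le
    have h5 : 5 / 4 ≤ x := by
      by_contra hc
      push Not at hc
      have h6 : (x - 1) * (1 - x ^ 3 * (x - 1)) ≤ 0 := by nlinarith
      have h7 : x ^ 3 ≤ (5/4) ^ 3 := by gcongr
      have h8 : x ^ 3 * (x - 1) ≤ (5/4) ^ 3 * (1/4) :=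
        mul_le_mul h7 (by linarith) (by linarith) (by positivity)
      have h9 : 0 < (x - 1) * (1 - x ^ 3 * (x - 1)) :=
        mul_pos (by linarith) (by norm_num at h8 ⊢; linarith)
      linarith
    have h10 : x ^ k * (2 - x) ≤ 1 := by
      have h3 : 0 < x ^ 3 := by positivity
      by_contra hc
      push Not at hc
      nlinarith [mul_lt_mul_of_pos_left hc h3]
    have h11 : (5/4 : ℝ) ^ k * (2 - x) ≤ 1 :=
      le_trans (mul_le_mul_of_nonneg_right (by gcongr) (by linarith)) h10
    have h12 : (4/5 : ℝ) ^ k * (5/4 : ℝ) ^ k = 1 := by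
      rw [← mul_pow]; norm_num
    have h13 := mul_le_mul_of_nonneg_left h11 (by positivity : (0:ℝ) ≤ (4/5 : ℝ) ^ k)
    rw [← mul_assoc, h12] at h13
    linarith
  have t : Filter.Tendsto (fun k : ℕ => 2 - (4/5 : ℝ) ^ k) Filter.atTop (nhds 2) := by
    simpa using (tendsto_pow_atTop_nhds_zero_of_lt_one (r := (4/5 : ℝ))
      (by norm_num) (by norm_num)).const_sub 2
  refine tendsto_of_tendsto_of_tendsto_of_le_of_le' t tendsto_const_nhds ?_ ?_
  · filter_upwards [Filter.eventually_ge_atTop 1] with k hk using key k hk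
  · filter_upwards [Filter.eventually_ge_atTop 1] with k hk using (hl k hk).2.1.le
end

section
/- Let γ : ℕ → ℝ be a sequence such that for every integer k ≥ 1, 1 < γ_k < 2 and γ_k^{k+3} − 2γ_k^{k+2} + γ_k^2 − γ_k + 1 = 0. Then γ_k tends to 2 as k tends to infinity. -/
theorem stmt_14 (g : ℕ → ℝ)
    (hg : ∀ k : ℕ, 1 ≤ k → 1 < g k ∧ g k < 2 ∧
      (g k) ^ (k + 3) - 2 * (g k) ^ (k + 2) + (g k) ^ 2 - g k + 1 = 0) :
    Filter.Tendsto g Filter.atTop (nhds 2) := by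
  have key : ∀ k : ℕ, 1 ≤ k → 2 - 3 * (1 / ((k : ℝ) + 1)) ≤ g k := by
    intro k hk
    obtain ⟨h1, h2, h3⟩ := hg k hk
    have hb := one_add_mul_le_pow (a := g k - 1) (by linarith) (k + 2)
    rw [add_sub_cancel] at hb
    push_cast at hb
    have h4 : (g k) ^ (k + 3) = (g k) ^ (k + 2) * g k := pow_succ _ _
    have h5 : ((g k) ^ (k + 2) - 1) * (2 - g k) = (g k - 1) * (g k + 1) := by
      rw [h4] at h3
      linarith
    have h6 : (((k : ℝ) + 2) * (g k - 1)) * (2 - g k) ≤ (g k - 1) * (g k + 1) := by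
      rw [← h5]
      exact mul_le_mul_of_nonneg_right (by linarith) (by linarith)
    have h7 : ((k : ℝ) + 2) * (2 - g k) ≤ g k + 1 := by
      refine le_of_mul_le_mul_left ?_ (sub_pos.mpr h1)
      linarith
    have hk0 : (0 : ℝ) < (k : ℝ) + 1 := by positivity
    have h8 : 2 - g k ≤ 3 / ((k : ℝ) + 1) := by
      rw [le_div_iff₀ hk0]
      linarith
    have h9 : 3 * (1 / ((k : ℝ) + 1)) = 3 / ((k : ℝ) + 1) := by ring
    linarith
  have hl : Filter.Tendsto (fun k : ℕ => 2 - 3 * (1 / ((k : ℝ) + 1))) Filter.atTop (nhds 2) := by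
    have := (tendsto_one_div_add_atTop_nhds_zero_nat (𝕜 := ℝ)).const_mul 3 |>.const_sub 2
    simpa using this
  refine tendsto_of_tendsto_of_tendsto_of_le_of_le' hl tendsto_const_nhds ?_ ?_
  · filter_upwards [Filter.eventually_ge_atTop 1] with k hk using key k hk
  · filter_upwards [Filter.eventually_ge_atTop 1] with k hk using (hg k hk).2.1.le
end

section
/- Let λ, γ : ℕ → ℝ be sequences such that for every integer k ≥ 1, 1 < λ_k < 2, 1 < γ_k < 2, λ_k^{k+4} − 2λ_k^{k+3} + λ_k^3 − λ_k + 1 = 0, and γ_k^{k+3} − 2γ_k^{k+2} + γ_k^2 − γ_k + 1 = 0. Then γ_k − λ_k tends to 0 as k tends to infinity. -/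
theorem aux_bound (x : ℝ) (n k : ℕ) (hn : 10 ≤ n) (hk : k ≤ n) (h1 : 1 < x) (h2 : x < 2)
    (h : (2 - x) * x ^ n ≤ x ^ 3 - x + 1) : 2 - x ≤ 7 * (2 / 3 : ℝ) ^ k := by
  have hb : 1 + (n : ℝ) * (x - 1) ≤ x ^ n := by
    have := one_add_mul_le_pow (a := x - 1) (by linarith) n
    simpa using this
  have hn' : (10 : ℝ) ≤ n := by exact_mod_cast hn
  have hx : 3 / 2 ≤ x := by
    by_contra! hc
    obtain ⟨t, rfl⟩ : ∃ t, x = 1 + t := ⟨x - 1, by ring⟩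
    have ht : 0 < t := by linarith
    have ht2 : t < 1 / 2 := by linarith
    have e1 : (1 - t) * (1 + 10 * t) ≤ (1 + t) ^ 3 - (1 + t) + 1 := by
      refine le_trans ?_ h
      have : 1 + 10 * t ≤ (1 + t) ^ n := by
        refine le_trans ?_ hb
        nlinarith
      have := mul_le_mul_of_nonneg_left this (by linarith : 0 ≤ 1 - t)
      linarith
    have e2 : t * (7 - 13 * t - t ^ 2) ≤ 0 := by nlinarith
    have e3 : 0 < 7 - 13 * t - t ^ 2 := by nlinarith
    nlinarith [mul_pos ht e3]
  have hp : (3 / 2 : ℝ) ^ k ≤ x ^ n :=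
    (pow_le_pow_left₀ (by norm_num) hx k).trans (pow_le_pow_right₀ h1.le hk)
  have h7 : x ^ 3 - x + 1 ≤ 7 := by nlinarith [mul_pos (sub_pos.2 h1) (sub_pos.2 h2)]
  have h8 : (2 - x) * (3 / 2 : ℝ) ^ k ≤ 7 :=
    (mul_le_mul_of_nonneg_left hp (by linarith)).trans (h.trans h7)
  have h9 : (3 / 2 : ℝ) ^ k * (2 / 3 : ℝ) ^ k = 1 := by
    rw [← mul_pow]; norm_num
  calc 2 - x = (2 - x) * (3 / 2 : ℝ) ^ k * (2 / 3 : ℝ) ^ k := by rw [mul_assoc, h9, mul_one]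
    _ ≤ _ := mul_le_mul_of_nonneg_right h8 (by positivity)

theorem stmt_15 (l g : ℕ → ℝ)
    (hl : ∀ k : ℕ, 1 ≤ k → 1 < l k ∧ l k < 2 ∧
      (l k) ^ (k + 4) - 2 * (l k) ^ (k + 3) + (l k) ^ 3 - l k + 1 = 0)
    (hg : ∀ k : ℕ, 1 ≤ k → 1 < g k ∧ g k < 2 ∧
      (g k) ^ (k + 3) - 2 * (g k) ^ (k + 2) + (g k) ^ 2 - g k + 1 = 0) :
    Filter.Tendsto (fun k => g k - l k) Filter.atTop (nhds 0) := by
  have ht : Filter.Tendsto (fun k : ℕ => 7 * (2 / 3 : ℝ) ^ k) Filter.atTop (nhds 0) := by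
    simpa using (tendsto_pow_atTop_nhds_zero_of_lt_one (r := (2 / 3 : ℝ))
      (by norm_num) (by norm_num)).const_mul 7
  refine squeeze_zero_norm' ?_ ht
  filter_upwards [Filter.eventually_ge_atTop 10] with k hk
  obtain ⟨a1, a2, a3⟩ := hl k (by omega)
  obtain ⟨b1, b2, b3⟩ := hg k (by omega)
  have A := aux_bound (l k) (k + 3) k (by omega) (by omega) a1 a2 (by
    have : l k ^ (k + 4) = l k * l k ^ (k + 3) := by ring
    rw [this] at a3
    linarith)
  have B := aux_bound (g k) (k + 2) k (by omega) (by omega) b1 b2 (by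
    have : g k ^ (k + 3) = g k * g k ^ (k + 2) := by ring
    rw [this] at b3
    have : g k ^ 2 ≤ g k ^ 3 := pow_le_pow_right₀ b1.le (by norm_num)
    linarith)
  rw [Real.norm_eq_abs, abs_le]
  constructor <;> linarith
end

section
/- Let G be a simple graph on a finite vertex type, let k be a natural number, and let S and Ψ be disjoint finite sets of vertices with nonEdges(S ∪ Ψ) ≤ k. Let v be a vertex not in S ∪ Ψ and let u ∈ Ψ be such that d̄_S(v) ≤ d̄_S(u) and v is adjacent to every vertex of Ψ \ {u}. Then nonEdges(S ∪ (Ψ \ {u}) ∪ {v}) ≤ k, i.e., replacing u by v again yields a k-defective clique. -/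
theorem nonEdges_insert_aux {V : Type*} [DecidableEq V] (G : SimpleGraph V) [DecidableRel G.Adj]
    (T : Finset V) (x : V) (hx : x ∉ T) :
    nonEdges G (insert x T) = nonEdges G T + nonDeg G T x := by
  have key : ((insert x T).offDiag.filter fun p => ¬ G.Adj p.1 p.2).card
      = (T.offDiag.filter fun p => ¬ G.Adj p.1 p.2).card + 2 * nonDeg G T x := by
    have h : ((insert x T).offDiag.filter fun p => ¬ G.Adj p.1 p.2)
        = (T.offDiag.filter fun p => ¬ G.Adj p.1 p.2) ∪
          ((T.filter fun w => w ≠ x ∧ ¬ G.Adj x w).image (fun w => (x, w)) ∪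
           (T.filter fun w => w ≠ x ∧ ¬ G.Adj x w).image (fun w => (w, x))) := by
      ext ⟨a, b⟩
      simp only [Finset.mem_filter, Finset.mem_offDiag, Finset.mem_insert, Finset.mem_union,
        Finset.mem_image, Prod.mk.injEq]
      have := G.adj_comm a b
      grind
    rw [h, Finset.card_union_of_disjoint, Finset.card_union_of_disjoint,
      Finset.card_image_of_injective, Finset.card_image_of_injective]
    · unfold nonDeg; ring
    · intro a b hab; simpa using hab
    · intro a b hab; simpa using hab
    · rw [Finset.disjoint_left]; rintro ⟨a, b⟩; simp; grind
    · rw [Finset.disjoint_left]; rintro ⟨a, b⟩; simp; grind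
  unfold nonEdges
  rw [key]
  omega

theorem stmt_16 {V : Type*} [Fintype V] [DecidableEq V]
    (G : SimpleGraph V) [DecidableRel G.Adj]
    (k : ℕ) (S Ψ : Finset V) (hSΨ : Disjoint S Ψ)
    (hk : nonEdges G (S ∪ Ψ) ≤ k)
    (v : V) (hv : v ∉ S ∪ Ψ)
    (u : V) (hu : u ∈ Ψ)
    (hdeg : nonDeg G S v ≤ nonDeg G S u)
    (hadj : ∀ w ∈ Ψ.erase u, G.Adj v w) :
    nonEdges G ((S ∪ Ψ.erase u) ∪ {v}) ≤ k := by
  have h1 : S ∪ Ψ = insert u (S ∪ Ψ.erase u) := by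
    ext a; simp; grind
  have huS : u ∉ S := fun h => Finset.disjoint_left.mp hSΨ h hu
  have h2 : (S ∪ Ψ.erase u) ∪ {v} = insert v (S ∪ Ψ.erase u) := by
    ext a; simp
  rw [h1, nonEdges_insert_aux G _ _ (by simp [huS])] at hk
  rw [h2, nonEdges_insert_aux G _ _ (by simp at hv ⊢; grind)]
  have h3 : nonDeg G (S ∪ Ψ.erase u) v ≤ nonDeg G S v := by
    apply Finset.card_le_card
    intro a
    simp only [Finset.mem_filter, Finset.mem_union]
    rintro ⟨h | h, h'⟩
    · exact ⟨h, h'⟩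
    · exact absurd (hadj a h) h'.2
  have h4 : nonDeg G S u ≤ nonDeg G (S ∪ Ψ.erase u) u :=
    Finset.card_le_card (Finset.filter_subset_filter _ Finset.subset_union_left)
  omega
end

section
/- Let G be a simple graph on a finite vertex type, let k be a natural number, and let S and Ψ be disjoint finite sets of vertices with nonEdges(S ∪ Ψ) ≤ k. Let v be a vertex not in S ∪ Ψ and let u ∈ Ψ be such that u is not adjacent to v, v has at most one non-neighbor in Ψ \ {u}, and d̄_S(v) < d̄_S(u). Then nonEdges(S ∪ (Ψ \ {u}) ∪ {v}) ≤ k, i.e., replacing u by v again yields a k-defective clique. -/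
theorem aux_insert {V : Type*} [DecidableEq V] (G : SimpleGraph V) [DecidableRel G.Adj]
    (T : Finset V) (x : V) (hx : x ∉ T) :
    ((insert x T).offDiag.filter fun p => ¬ G.Adj p.1 p.2).card =
      (T.offDiag.filter fun p => ¬ G.Adj p.1 p.2).card + nonDeg G T x + nonDeg G T x := by
  have h : ((insert x T).offDiag.filter fun p => ¬ G.Adj p.1 p.2) =
      ((T.offDiag.filter fun p => ¬ G.Adj p.1 p.2) ∪
        (T.filter fun w => w ≠ x ∧ ¬ G.Adj x w).image (fun w => (x, w))) ∪
        (T.filter fun w => w ≠ x ∧ ¬ G.Adj x w).image (fun w => (w, x)) := by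
    ext ⟨a, b⟩
    have := G.adj_comm a b
    simp only [Finset.mem_filter, Finset.mem_offDiag, Finset.mem_insert, Finset.mem_union,
      Finset.mem_image, Prod.mk.injEq]
    grind
  rw [h, Finset.card_union_of_disjoint, Finset.card_union_of_disjoint,
    Finset.card_image_of_injective, Finset.card_image_of_injective]
  · rfl
  · intro a b hab; simpa using hab
  · intro a b hab; simpa using hab
  · rw [Finset.disjoint_left]
    rintro ⟨a, b⟩
    simp only [Finset.mem_filter, Finset.mem_offDiag, Finset.mem_image, Prod.mk.injEq]
    grind
  · rw [Finset.disjoint_left]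
    rintro ⟨a, b⟩
    simp only [Finset.mem_filter, Finset.mem_offDiag, Finset.mem_union, Finset.mem_image,
      Prod.mk.injEq]
    grind

theorem stmt_17 {V : Type*} [Fintype V] [DecidableEq V]
    (G : SimpleGraph V) [DecidableRel G.Adj]
    (k : ℕ) (S Ψ : Finset V) (hSΨ : Disjoint S Ψ)
    (hk : nonEdges G (S ∪ Ψ) ≤ k)
    (v : V) (hv : v ∉ S ∪ Ψ)
    (u : V) (hu : u ∈ Ψ)
    (huv : ¬ G.Adj u v)
    (hone : nonDeg G (Ψ.erase u) v ≤ 1)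
    (hdeg : nonDeg G S v < nonDeg G S u) :
    nonEdges G ((S ∪ Ψ.erase u) ∪ {v}) ≤ k := by
  have e1 : S ∪ Ψ = insert u (S ∪ Ψ.erase u) := by
    ext a; simp only [Finset.mem_union, Finset.mem_insert, Finset.mem_erase]; grind
  have e2 : (S ∪ Ψ.erase u) ∪ {v} = insert v (S ∪ Ψ.erase u) := by
    ext a; simp only [Finset.mem_union, Finset.mem_insert, Finset.mem_singleton]; grind
  have huT : u ∉ S ∪ Ψ.erase u := by
    have := Finset.disjoint_right.mp hSΨ hu
    simp [this]
  have hvT : v ∉ S ∪ Ψ.erase u := by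
    simp only [Finset.mem_union, Finset.mem_erase] at hv ⊢; tauto
  have h1 : nonDeg G (S ∪ Ψ.erase u) v ≤ nonDeg G S v + nonDeg G (Ψ.erase u) v := by
    unfold nonDeg
    rw [Finset.filter_union]
    exact Finset.card_union_le _ _
  have h2 : nonDeg G S u ≤ nonDeg G (S ∪ Ψ.erase u) u := by
    unfold nonDeg
    exact Finset.card_le_card (Finset.filter_subset_filter _ Finset.subset_union_left)
  refine le_trans ?_ hk
  unfold nonEdges
  rw [e2, e1, aux_insert G _ u huT, aux_insert G _ v hvT]
  apply Nat.div_le_div_right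
  omega
end

section
/- Let G be a simple graph on a finite vertex type, let k be a natural number, and let S and C be disjoint finite sets of vertices. Suppose v ∈ C satisfies d̄_S(v) ≤ d̄_S(w) for every w ∈ C, and nonEdges(S) + d̄_S(v) > k. Then for every u ∈ C, nonEdges(S ∪ {u}) > k; that is, no vertex of C can be added to S while keeping a k-defective clique. -/
theorem stmt_19 {V : Type*} [Fintype V] [DecidableEq V]
    (G : SimpleGraph V) [DecidableRel G.Adj]
    (k : ℕ) (S C : Finset V) (hSC : Disjoint S C)
    (v : V) (hv : v ∈ C)
    (hmin : ∀ w ∈ C, nonDeg G S v ≤ nonDeg G S w)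
    (hbig : k < nonEdges G S + nonDeg G S v) :
    ∀ u ∈ C, k < nonEdges G (S ∪ {u}) := by
  intro u hu
  have huS : u ∉ S := fun h => (Finset.disjoint_left.mp hSC h) hu
  have hm := hmin u hu
  set D := S.filter fun w => w ≠ u ∧ ¬ G.Adj u w with hD
  set A := S.offDiag.filter fun p => ¬ G.Adj p.1 p.2 with hA
  set B := (S ∪ {u}).offDiag.filter fun p => ¬ G.Adj p.1 p.2 with hB
  have hd : nonDeg G S u = D.card := rfl
  have ha : nonEdges G S = A.card / 2 := rfl
  have hb : nonEdges G (S ∪ {u}) = B.card / 2 := rfl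
  have h1 : (D.image fun w => (u, w)).card = D.card :=
    Finset.card_image_of_injective _ (fun a b h => (Prod.mk.inj h).2)
  have h2 : (D.image fun w => (w, u)).card = D.card :=
    Finset.card_image_of_injective _ (fun a b h => (Prod.mk.inj h).1)
  have d1 : Disjoint (D.image fun w => (u, w)) (D.image fun w => (w, u)) := by
    rw [Finset.disjoint_left]
    rintro ⟨a, b⟩ h h'
    simp only [hD, Finset.mem_image, Finset.mem_filter, Prod.mk.injEq] at h h'
    grind
  have d2 : Disjoint A ((D.image fun w => (u, w)) ∪ (D.image fun w => (w, u))) := by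
    rw [Finset.disjoint_left]
    rintro ⟨a, b⟩ h h'
    simp only [hD, hA, Finset.mem_union, Finset.mem_offDiag, Finset.mem_image,
      Finset.mem_filter, Prod.mk.injEq] at h h'
    grind
  have hsub : A ∪ ((D.image fun w => (u, w)) ∪ (D.image fun w => (w, u))) ⊆ B := by
    rintro ⟨a, b⟩ h
    simp only [hD, hA, hB, Finset.mem_union, Finset.mem_offDiag, Finset.mem_image,
      Finset.mem_filter, Prod.mk.injEq, Finset.mem_singleton] at h ⊢
    have := G.adj_comm a b
    grind
  have hc := Finset.card_le_card hsub
  rw [Finset.card_union_of_disjoint d2, Finset.card_union_of_disjoint d1, h1, h2] at hc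
  omega
end
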